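/- arXiv:2103.08998 — 2 statements merged into one kernel-verified Lean document; each statement's English description precedes it below -/
import Mathlib

section
/- Let a < b, ν > 0, let c : [a,b] → ℝ be continuously differentiable with c(a) ≤ 0 and c(ξ) − c'(ξ) ≤ −ν for all ξ ∈ [a,b], and let u : [a,b] × [0,∞) → ℝ be continuously differentiable, satisfy ∂u/∂t(ξ,t) + ∂/∂ξ( c(ξ)·u(ξ,t) ) = 0 for all ξ ∈ [a,b], t ≥ 0, together with the boundary (control) condition u(b,t) = 0 for all t ≥ 0. Then the Lyapunov functional V(t) = (1/2)·∫_a^b e^ξ·u(ξ,t)² dξ satisfies V'(t) ≤ −ν·V(t) for all t ≥ 0; consequently V(t) ≤ V(0)·e^{−ν t} for all t ≥ 0, and the L²-norm (∫_a^b u(ξ,t)² dξ)^{1/2} tends to 0 as t → ∞. -/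
open Set intervalIntegral Filter

/-- Differentiation under the integral sign on a closed half-line, including its endpoint. -/
theorem hasDerivWithinAt_intervalIntegral_Ici {F F' : ℝ → ℝ → ℝ} {a b t₀ : ℝ} (hab : a ≤ b)
    (hF : ∀ x ∈ Icc a b, ∀ t ∈ Ici t₀, HasDerivWithinAt (F x) (F' x t) (Ici t₀) t)
    (hF_cont : ContinuousOn (fun x => F x t₀) (Icc a b))
    (hF'_cont : ContinuousOn (fun p : ℝ × ℝ => F' p.1 p.2) (Icc a b ×ˢ Ici t₀))
    {t : ℝ} (ht : t ∈ Ici t₀) :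
    HasDerivWithinAt (fun s => ∫ x in a..b, F x s) (∫ x in a..b, F' x t) (Ici t₀) t := by
  set G : ℝ → ℝ → ℝ := fun x s => F' (projIcc a b hab x) (max t₀ s) with hG
  have hG_cont : Continuous (Function.uncurry G) := by
    refine hF'_cont.comp_continuous
      (f := fun p : ℝ × ℝ => ((projIcc a b hab p.1 : ℝ), max t₀ p.2)) ?_ ?_
    · exact (continuous_subtype_val.comp (continuous_projIcc.comp continuous_fst)).prodMk
        (continuous_const.max continuous_snd)
    · exact fun p => ⟨(projIcc a b hab p.1).2, mem_Ici.mpr (le_max_left t₀ p.2)⟩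
  have hG_eq : ∀ x ∈ Icc a b, ∀ s ∈ Ici t₀, G x s = F' x s := by
    intro x hx s hs
    simp only [hG, projIcc_of_mem hab hx, max_eq_right (mem_Ici.mp hs)]
  have hG_cont' : Continuous fun s => ∫ x in a..b, G x s :=
    continuous_parametric_intervalIntegral_of_continuous' (f := fun s x => G x s)
      (hG_cont.comp continuous_swap) a b
  have hrep : ∀ s ∈ Ici t₀, ∫ x in a..b, F x s =
      (∫ x in a..b, F x t₀) + ∫ r in t₀..s, ∫ x in a..b, G x r := by
    intro s hs
    have hswap : ∫ r in t₀..s, ∫ x in a..b, G x r = ∫ x in a..b, ∫ r in t₀..s, G x r := by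
      symm
      apply MeasureTheory.intervalIntegral_intervalIntegral_swap
      exact (hG_cont.continuousOn.integrableOn_compact
        (isCompact_uIcc.prod isCompact_uIcc)).mono_set (prod_mono uIoc_subset_uIcc uIoc_subset_uIcc)
    have hprim : Continuous fun x => ∫ r in t₀..s, G x r :=
      continuous_parametric_intervalIntegral_of_continuous' hG_cont t₀ s
    rw [hswap, ← integral_add
      (ContinuousOn.intervalIntegrable_of_Icc hab hF_cont) (hprim.intervalIntegrable _ _)]
    refine integral_congr fun x hx => ?_
    rw [uIcc_of_le hab] at hx
    have hFTC : ∫ r in t₀..s, G x r = F x s - F x t₀ := by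
      refine integral_eq_sub_of_hasDeriv_right_of_le (mem_Ici.mp hs) ?_ ?_ ?_
      · exact fun r hr => (hF x hx r hr.1).continuousWithinAt.mono Icc_subset_Ici_self
      · intro r hr
        rw [hG_eq x hx r hr.1.le]
        exact (hF x hx r hr.1.le).mono fun y hy => hr.1.le.trans (le_of_lt hy)
      · exact (hG_cont.comp (continuous_const.prodMk continuous_id)).intervalIntegrable _ _
    change F x s = F x t₀ + ∫ r in t₀..s, G x r
    rw [hFTC]; ring
  have hval : ∫ x in a..b, F' x t = ∫ x in a..b, G x t := by
    refine integral_congr fun x hx => ?_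
    rw [uIcc_of_le hab] at hx
    exact (hG_eq x hx t ht).symm
  rw [hval]
  exact ((hG_cont'.integral_hasStrictDerivAt t₀ t).hasDerivAt.const_add _).hasDerivWithinAt.congr
    hrep (hrep t ht)

/-- A Grönwall inequality: `V' ≤ -ν V` on `[0, ∞)` forces exponential decay. -/
theorem le_mul_exp_of_hasDerivWithinAt_le {V : ℝ → ℝ} {ν : ℝ}
    (hV : ∀ t ∈ Ici (0 : ℝ), ∃ d : ℝ, HasDerivWithinAt V d (Ici 0) t ∧ d ≤ -ν * V t)
    {t : ℝ} (ht : t ∈ Ici (0 : ℝ)) : V t ≤ V 0 * Real.exp (-ν * t) := by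
  choose! d hd hle using hV
  have hexp : ∀ s, HasDerivAt (fun s => Real.exp (ν * s)) (Real.exp (ν * s) * ν) s := fun s => by
    simpa using ((hasDerivAt_id s).const_mul ν).exp
  have hderiv : ∀ s ∈ Ici (0 : ℝ), HasDerivWithinAt (fun s => V s * Real.exp (ν * s))
      (d s * Real.exp (ν * s) + V s * (Real.exp (ν * s) * ν)) (Ici 0) s :=
    fun s hs => (hd s hs).mul (hexp s).hasDerivWithinAt
  have hanti : AntitoneOn (fun s => V s * Real.exp (ν * s)) (Ici 0) := by
    refine antitoneOn_of_hasDerivWithinAt_nonpos (convex_Ici 0)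
      (fun s hs => (hderiv s hs).continuousWithinAt)
      (fun s hs => (hderiv s (interior_subset hs)).mono interior_subset) fun s hs => ?_
    nlinarith [hle s (interior_subset hs), Real.exp_pos (ν * s)]
  have h := hanti (mem_Ici.mpr le_rfl) ht (mem_Ici.mp ht)
  simp only [mul_zero, Real.exp_zero, mul_one] at h
  rw [neg_mul, Real.exp_neg, ← div_eq_mul_inv, le_div_iff₀ (Real.exp_pos _)]
  exact h

/-- Let `a < b`, `ν > 0`, let `c` be continuously differentiable on `[a,b]` with `c(a) ≤ 0`
and `c(ξ) − c'(ξ) ≤ −ν` on `[a,b]`, and let `u(ξ,t)` be continuously differentiable on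
`[a,b] × [0,∞)`, satisfy the linearized conservation law `∂u/∂t + ∂/∂ξ(c(ξ)·u) = 0` there,
and the boundary (control) condition `u(b,t) = 0` for all `t ≥ 0`. Then the Lyapunov
functional `V(t) = (1/2)·∫_a^b e^ξ·u(ξ,t)² dξ` is differentiable with `V'(t) ≤ −ν·V(t)` for
all `t ≥ 0`; consequently `V(t) ≤ V(0)·e^{−νt}`, and the `L²`-norm
`(∫_a^b u(ξ,t)² dξ)^{1/2}` tends to `0` as `t → ∞`. -/
theorem lyapunov_boundary_control_L2_convergence
    (a b ν : ℝ) (hab : a < b) (hν : 0 < ν)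
    (c c' : ℝ → ℝ) (u ut uξ : ℝ → ℝ → ℝ)
    (hc : ∀ ξ ∈ Icc a b, HasDerivAt c (c' ξ) ξ)
    (hc' : ContinuousOn c' (Icc a b))
    (hca : c a ≤ 0)
    (hcν : ∀ ξ ∈ Icc a b, c ξ - c' ξ ≤ -ν)
    (hut : ∀ ξ ∈ Icc a b, ∀ t ∈ Ici (0:ℝ), HasDerivAt (fun s => u ξ s) (ut ξ t) t)
    (huξ : ∀ ξ ∈ Icc a b, ∀ t ∈ Ici (0:ℝ), HasDerivAt (fun x => u x t) (uξ ξ t) ξ)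
    (hu_cont : ContinuousOn (fun p : ℝ × ℝ => u p.1 p.2) (Icc a b ×ˢ Ici 0))
    (hut_cont : ContinuousOn (fun p : ℝ × ℝ => ut p.1 p.2) (Icc a b ×ˢ Ici 0))
    (huξ_cont : ContinuousOn (fun p : ℝ × ℝ => uξ p.1 p.2) (Icc a b ×ˢ Ici 0))
    (hpde : ∀ ξ ∈ Icc a b, ∀ t ∈ Ici (0:ℝ),
      ut ξ t + (c' ξ * u ξ t + c ξ * uξ ξ t) = 0)
    (hbc : ∀ t ∈ Ici (0:ℝ), u b t = 0)
    (V : ℝ → ℝ)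
    (hV : ∀ t, V t = (1/2) * ∫ ξ in a..b, Real.exp ξ * (u ξ t) ^ 2) :
    (∀ t ∈ Ici (0:ℝ), ∃ d : ℝ, HasDerivWithinAt V d (Ici 0) t ∧ d ≤ -ν * V t) ∧
    (∀ t ∈ Ici (0:ℝ), V t ≤ V 0 * Real.exp (-ν * t)) ∧
    Tendsto (fun t => Real.sqrt (∫ ξ in a..b, (u ξ t) ^ 2)) atTop (nhds 0) := by
  have hslice : ∀ {f : ℝ → ℝ → ℝ},
      ContinuousOn (fun p : ℝ × ℝ => f p.1 p.2) (Icc a b ×ˢ Ici 0) →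
      ∀ t ∈ Ici (0 : ℝ), ContinuousOn (fun x => f x t) (Icc a b) := fun hf t ht =>
    hf.comp (f := fun x : ℝ => (x, t)) (by fun_prop) fun x hx => ⟨hx, ht⟩
  have hexp : ContinuousOn Real.exp (Icc a b) := Real.continuous_exp.continuousOn
  have hc_cont : ContinuousOn c (Icc a b) := fun x hx => (hc x hx).continuousAt.continuousWithinAt
  have hVderiv : ∀ t ∈ Ici (0 : ℝ), HasDerivWithinAt V
      (∫ x in a..b, Real.exp x * (u x t * ut x t)) (Ici 0) t := by
    intro t ht
    have h := hasDerivWithinAt_intervalIntegral_Ici (t₀ := 0)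
      (F := fun x s => (1 / 2) * (Real.exp x * u x s ^ 2))
      (F' := fun x s => Real.exp x * (u x s * ut x s)) hab.le ?_ ?_ ?_ ht
    · refine h.congr_of_mem (fun s _ => ?_) ht
      rw [hV, intervalIntegral.integral_const_mul]
    · intro x hx s hs
      have h := (((hut x hx s hs).pow 2).const_mul (Real.exp x)).const_mul (1 / 2)
      refine (h.congr_deriv ?_).hasDerivWithinAt
      push_cast
      ring
    · exact continuousOn_const.mul
        (hexp.mul ((hslice hu_cont 0 (mem_Ici.mpr le_rfl)).pow 2))
    · exact (Real.continuous_exp.comp continuous_fst).continuousOn.mul (hu_cont.mul hut_cont)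
  have hdiss : ∀ t ∈ Ici (0 : ℝ),
      ∫ x in a..b, Real.exp x * (u x t * ut x t) ≤ -ν * V t := by
    intro t ht
    have hu := hslice hu_cont t ht
    have hux := hslice huξ_cont t ht
    have hw := hslice hut_cont t ht
    set flux' : ℝ → ℝ := fun x =>
      (Real.exp x * c x + Real.exp x * c' x) * u x t ^ 2 +
        (Real.exp x * c x) * (2 * u x t * uξ x t) with hflux'
    have hflux_cont : ContinuousOn flux' (Icc a b) := by
      fun_prop
    have hflux : ∫ x in a..b, flux' x = -(Real.exp a * c a * u a t ^ 2) := by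
      rw [integral_eq_sub_of_hasDerivAt (f := fun x => Real.exp x * c x * u x t ^ 2) ?_
        (hflux_cont.intervalIntegrable_of_Icc hab.le), hbc t ht]
      · ring
      · intro x hx
        rw [uIcc_of_le hab.le] at hx
        refine (((Real.hasDerivAt_exp x).mul (hc x hx)).mul ((huξ x hx t ht).pow 2)).congr_deriv ?_
        simp only [hflux', Pi.mul_apply, Pi.pow_apply]
        push_cast
        ring
    have hE_cont : ContinuousOn (fun x => Real.exp x * u x t ^ 2) (Icc a b) := by fun_prop
    have hmono : ∫ x in a..b, Real.exp x * (u x t * ut x t) ≤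
        ∫ x in a..b, ((-1 / 2) * flux' x + (-ν / 2) * (Real.exp x * u x t ^ 2)) := by
      refine integral_mono_on hab.le ?_ ?_ fun x hx => ?_
      · exact ContinuousOn.intervalIntegrable_of_Icc hab.le (by fun_prop)
      · exact ContinuousOn.intervalIntegrable_of_Icc hab.le (by fun_prop)
      · have hut_eq : ut x t = -(c' x * u x t + c x * uξ x t) := by linarith [hpde x hx t ht]
        have hpos : 0 ≤ Real.exp x * u x t ^ 2 := by positivity
        simp only [hflux', hut_eq]
        nlinarith [mul_le_mul_of_nonneg_right (hcν x hx) hpos]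
    rw [intervalIntegral.integral_add
        ((hflux_cont.intervalIntegrable_of_Icc hab.le).const_mul _)
        ((hE_cont.intervalIntegrable_of_Icc hab.le).const_mul _),
      intervalIntegral.integral_const_mul, intervalIntegral.integral_const_mul, hflux] at hmono
    rw [hV]
    have hbdry : Real.exp a * c a * u a t ^ 2 ≤ 0 :=
      mul_nonpos_of_nonpos_of_nonneg
        (mul_nonpos_of_nonneg_of_nonpos (Real.exp_pos a).le hca) (sq_nonneg _)
    linarith
  have hode : ∀ t ∈ Ici (0 : ℝ), ∃ d : ℝ, HasDerivWithinAt V d (Ici 0) t ∧ d ≤ -ν * V t :=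
    fun t ht => ⟨_, hVderiv t ht, hdiss t ht⟩
  have hdecay : ∀ t ∈ Ici (0 : ℝ), V t ≤ V 0 * Real.exp (-ν * t) :=
    fun t ht => le_mul_exp_of_hasDerivWithinAt_le hode ht
  refine ⟨hode, hdecay, ?_⟩
  have hL2 : ∀ t ∈ Ici (0 : ℝ),
      ∫ x in a..b, u x t ^ 2 ≤ 2 * Real.exp (-a) * (V 0 * Real.exp (-ν * t)) := by
    intro t ht
    have hu := hslice hu_cont t ht
    have hle : ∫ x in a..b, u x t ^ 2 ≤
        ∫ x in a..b, Real.exp (-a) * (Real.exp x * u x t ^ 2) := by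
      refine integral_mono_on hab.le ?_ ?_ fun x hx => ?_
      · exact ContinuousOn.intervalIntegrable_of_Icc hab.le (by fun_prop)
      · exact ContinuousOn.intervalIntegrable_of_Icc hab.le (by fun_prop)
      · rw [← mul_assoc, ← Real.exp_add]
        exact le_mul_of_one_le_left (sq_nonneg _) (Real.one_le_exp (by linarith [hx.1]))
    rw [intervalIntegral.integral_const_mul] at hle
    have h := hdecay t ht
    rw [hV t] at h
    nlinarith [mul_le_mul_of_nonneg_left h (Real.exp_pos (-a)).le]
  have hlim : Tendsto (fun t => 2 * Real.exp (-a) * (V 0 * Real.exp (-ν * t))) atTop (nhds 0) := by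
    have h : Tendsto (fun t => Real.exp (-ν * t)) atTop (nhds 0) :=
      Real.tendsto_exp_atBot.comp (tendsto_id.const_mul_atTop_of_neg (neg_lt_zero.mpr hν))
    simpa using (h.const_mul (V 0)).const_mul (2 * Real.exp (-a))
  have hsq : Tendsto (fun t => ∫ x in a..b, u x t ^ 2) atTop (nhds 0) := by
    refine tendsto_of_tendsto_of_tendsto_of_le_of_le' tendsto_const_nhds hlim ?_ ?_
    · exact Eventually.of_forall fun t => integral_nonneg hab.le fun x _ => sq_nonneg _
    · filter_upwards [eventually_ge_atTop 0] with t ht using hL2 t ht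
  simpa using hsq.sqrt
end

section
/- Let a < b and let v : [a,b] → ℝ and ρ_max : [a,b] → ℝ be continuous with v(ξ) > 0 and ρ_max(ξ) > 0 for all ξ; write φ_max(ξ) = v(ξ)·ρ_max(ξ)/4 and Φ(ξ,ρ) = v(ξ)·ρ·(1 − ρ/ρ_max(ξ)). Then for 0 ≤ φ_d the following are equivalent: (i) there exists a strictly congested stationary profile, i.e. ρ : [a,b] → ℝ with ρ_max(ξ)/2 < ρ(ξ) ≤ ρ_max(ξ) and Φ(ξ, ρ(ξ)) = φ_d for all ξ ∈ [a,b]; (ii) φ_d < min_{ξ ∈ [a,b]} φ_max(ξ). In particular, for every ε with 0 < ε ≤ min_ξ φ_max(ξ), the desired flow φ_d = min_ξ φ_max(ξ) − ε admits the strictly congested profile ρ_d(ξ) = ρ_max(ξ)/2 + sqrt(ρ_max(ξ)²/4 − (ρ_max(ξ)/v(ξ))·φ_d), whereas φ_d = min_ξ φ_max(ξ) (the case ε = 0) admits no strictly congested profile; this is why the ε-optimal desired state subtracts ε > 0 from the bottleneck capacity. -/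
open Set

theorem greenshields_flux_eq (V R r : ℝ) (hR : R ≠ 0) :
    V * r * (1 - r / R) = V * R / 4 - V / R * (r - R / 2) ^ 2 := by
  field_simp
  ring

theorem greenshields_flux_lt_capacity {V R r : ℝ} (hV : 0 < V) (hR : 0 < R) (hr : R / 2 < r) :
    V * r * (1 - r / R) < V * R / 4 := by
  rw [greenshields_flux_eq V R r hR.ne']
  have : 0 < V / R * (r - R / 2) ^ 2 := mul_pos (div_pos hV hR) (pow_pos (sub_pos.2 hr) 2)
  linarith

theorem greenshields_congested_branch {V R φ : ℝ} (hV : 0 < V) (hR : 0 < R) (h0 : 0 ≤ φ)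
    (hφ : φ < V * R / 4) :
    R / 2 < R / 2 + Real.sqrt (R ^ 2 / 4 - R / V * φ) ∧
      R / 2 + Real.sqrt (R ^ 2 / 4 - R / V * φ) ≤ R ∧
      V * (R / 2 + Real.sqrt (R ^ 2 / 4 - R / V * φ))
        * (1 - (R / 2 + Real.sqrt (R ^ 2 / 4 - R / V * φ)) / R) = φ := by
  have hRV : 0 < R / V := div_pos hR hV
  have hpos : 0 < R ^ 2 / 4 - R / V * φ := by
    have h1 := mul_lt_mul_of_pos_left hφ hRV
    have h2 : R / V * (V * R / 4) = R ^ 2 / 4 := by field_simp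
    linarith
  refine ⟨lt_add_of_pos_right _ (Real.sqrt_pos.2 hpos), ?_, ?_⟩
  · have : Real.sqrt (R ^ 2 / 4 - R / V * φ) ≤ R / 2 :=
      Real.sqrt_le_iff.2 ⟨by positivity, by nlinarith [mul_nonneg hRV.le h0]⟩
    linarith
  · rw [greenshields_flux_eq V R _ hR.ne', add_sub_cancel_left, Real.sq_sqrt hpos.le]
    field_simp
    ring

/-- Along a path `[a,b]` with continuous `v > 0`, `ρ_max > 0`, capacity
`φ_max(ξ) = v(ξ)·ρ_max(ξ)/4` and Greenshields flux `Φ(ξ,ρ) = v(ξ)·ρ·(1 − ρ/ρ_max(ξ))`,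
a constant flow `φ_d ≥ 0` is carried by some strictly congested stationary profile
`ρ(ξ) ∈ (ρ_max(ξ)/2, ρ_max(ξ)]` iff `φ_d < min_{ξ∈[a,b]} φ_max(ξ)`. In particular, for every
`ε` with `0 < ε ≤ min_ξ φ_max(ξ)`, the desired flow `φ_d = min_ξ φ_max(ξ) − ε` admits the
strictly congested profile `ρ_d(ξ) = ρ_max(ξ)/2 + √(ρ_max(ξ)²/4 − (ρ_max(ξ)/v(ξ))·φ_d)`,
whereas `φ_d = min_ξ φ_max(ξ)` (the case `ε = 0`) admits no strictly congested profile. -/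
theorem strictly_congested_profile_iff_below_capacity
    (a b : ℝ) (hab : a < b)
    (v ρmax : ℝ → ℝ)
    (hv_cont : ContinuousOn v (Icc a b)) (hρmax_cont : ContinuousOn ρmax (Icc a b))
    (hv_pos : ∀ ξ ∈ Icc a b, 0 < v ξ) (hρmax_pos : ∀ ξ ∈ Icc a b, 0 < ρmax ξ) :
    (∀ φd : ℝ, 0 ≤ φd →
      ((∃ ρ : ℝ → ℝ, ∀ ξ ∈ Icc a b,
          ρmax ξ / 2 < ρ ξ ∧ ρ ξ ≤ ρmax ξ ∧ v ξ * ρ ξ * (1 - ρ ξ / ρmax ξ) = φd) ↔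
        φd < sInf ((fun ξ => v ξ * ρmax ξ / 4) '' Icc a b))) ∧
    (∀ ε : ℝ, 0 < ε → ε ≤ sInf ((fun ξ => v ξ * ρmax ξ / 4) '' Icc a b) →
      ∀ ξ ∈ Icc a b,
        ρmax ξ / 2 <
          ρmax ξ / 2 + Real.sqrt (ρmax ξ ^ 2 / 4
            - (ρmax ξ / v ξ) * (sInf ((fun ζ => v ζ * ρmax ζ / 4) '' Icc a b) - ε)) ∧
        ρmax ξ / 2 + Real.sqrt (ρmax ξ ^ 2 / 4
            - (ρmax ξ / v ξ) * (sInf ((fun ζ => v ζ * ρmax ζ / 4) '' Icc a b) - ε))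
          ≤ ρmax ξ ∧
        v ξ * (ρmax ξ / 2 + Real.sqrt (ρmax ξ ^ 2 / 4
            - (ρmax ξ / v ξ) * (sInf ((fun ζ => v ζ * ρmax ζ / 4) '' Icc a b) - ε)))
          * (1 - (ρmax ξ / 2 + Real.sqrt (ρmax ξ ^ 2 / 4
              - (ρmax ξ / v ξ) * (sInf ((fun ζ => v ζ * ρmax ζ / 4) '' Icc a b) - ε)))
            / ρmax ξ)
          = sInf ((fun ζ => v ζ * ρmax ζ / 4) '' Icc a b) - ε) ∧
    ¬ (∃ ρ : ℝ → ℝ, ∀ ξ ∈ Icc a b,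
        ρmax ξ / 2 < ρ ξ ∧ ρ ξ ≤ ρmax ξ ∧
        v ξ * ρ ξ * (1 - ρ ξ / ρmax ξ)
          = sInf ((fun ζ => v ζ * ρmax ζ / 4) '' Icc a b)) := by
  have hcompact : IsCompact ((fun ξ => v ξ * ρmax ξ / 4) '' Icc a b) :=
    isCompact_Icc.image_of_continuousOn ((hv_cont.mul hρmax_cont).div_const 4)
  have hne : ((fun ξ => v ξ * ρmax ξ / 4) '' Icc a b).Nonempty :=
    (nonempty_Icc.2 hab.le).image _
  have hle : ∀ ξ ∈ Icc a b,
      sInf ((fun ξ => v ξ * ρmax ξ / 4) '' Icc a b) ≤ v ξ * ρmax ξ / 4 :=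
    fun ξ hξ => csInf_le hcompact.bddBelow (mem_image_of_mem _ hξ)
  have hbelow : ∀ φ : ℝ, (∃ ρ : ℝ → ℝ, ∀ ξ ∈ Icc a b,
      ρmax ξ / 2 < ρ ξ ∧ ρ ξ ≤ ρmax ξ ∧ v ξ * ρ ξ * (1 - ρ ξ / ρmax ξ) = φ) →
      φ < sInf ((fun ξ => v ξ * ρmax ξ / 4) '' Icc a b) := by
    rintro φ ⟨ρ, hρ⟩
    obtain ⟨ξ, hξ, hmin⟩ := hcompact.sInf_mem hne
    obtain ⟨hlt, -, hflux⟩ := hρ ξ hξ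
    rw [← hmin, ← hflux]
    exact greenshields_flux_lt_capacity (hv_pos ξ hξ) (hρmax_pos ξ hξ) hlt
  refine ⟨fun φd h0 => ⟨hbelow φd, fun hφ => ⟨_, fun ξ hξ =>
    greenshields_congested_branch (hv_pos ξ hξ) (hρmax_pos ξ hξ) h0 (hφ.trans_le (hle ξ hξ))⟩⟩,
    fun ε hε hεle ξ hξ => greenshields_congested_branch (hv_pos ξ hξ) (hρmax_pos ξ hξ)
      (sub_nonneg.2 hεle) ((sub_lt_self _ hε).trans_le (hle ξ hξ)),
    fun h => lt_irrefl _ (hbelow _ h)⟩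
end
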